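/- Uniqueness of bounded solutions bounded away from zero: Let a, b : ℝ^m → ℝ be continuous (m ≥ 2), suppose b(x) ≥ C(1 + |x|)^{−μ} for some C > 0 and 0 ≤ μ < 2, and sup_{ℝ^m} a₋/b < +∞ where a₋ = max(−a, 0). Let σ > 1 and let u, v be nonnegative C² solutions of Δu + a(x)u − b(x)u^σ = 0 on ℝ^m, each satisfying 0 < liminf_{|x|→∞} u(x) ≤ limsup_{|x|→∞} u(x) < +∞. Then u = v. -/

import Mathlib

open MeasureTheory Metric Set Filter

/-- The Euclidean Laplacian: the sum of the unmixed second partial derivatives. -/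
noncomputable def lap {m : ℕ} (u : EuclideanSpace ℝ (Fin m) → ℝ) (x : EuclideanSpace ℝ (Fin m)) : ℝ :=
  ∑ i : Fin m, fderiv ℝ (fun y => fderiv ℝ u y (EuclideanSpace.single i 1)) x (EuclideanSpace.single i 1)


/-- Linearity of the Laplacian. -/
lemma lap_sub_mul {m : ℕ} {f g : EuclideanSpace ℝ (Fin m) → ℝ} (hf : ContDiff ℝ 2 f)
    (hg : ContDiff ℝ 2 g) (c : ℝ) (x : EuclideanSpace ℝ (Fin m)) :
    lap (fun y => f y - c * g y) x = lap f x - c * lap g x := by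
  have hf1 : Differentiable ℝ f := hf.differentiable (by norm_num)
  have hg1 : Differentiable ℝ g := hg.differentiable (by norm_num)
  have hf2 : Differentiable ℝ (fderiv ℝ f) :=
    (hf.fderiv_right (m := 1) (by norm_num)).differentiable (by norm_num)
  have hg2 : Differentiable ℝ (fderiv ℝ g) :=
    (hg.fderiv_right (m := 1) (by norm_num)).differentiable (by norm_num)
  unfold lap
  rw [Finset.mul_sum, ← Finset.sum_sub_distrib]
  refine Finset.sum_congr rfl fun i _ => ?_
  have h1 : (fun y => fderiv ℝ (fun y => f y - c * g y) y (EuclideanSpace.single i 1))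
      = fun y => fderiv ℝ f y (EuclideanSpace.single i 1)
        - c * fderiv ℝ g y (EuclideanSpace.single i 1) := by
    funext y
    rw [fderiv_fun_sub (hf1 y) ((hg1 y).const_mul c), fderiv_const_mul (hg1 y)]
    simp
  have hfe : DifferentiableAt ℝ (fun y => fderiv ℝ f y (EuclideanSpace.single i 1)) x :=
    (hf2 x).clm_apply (differentiableAt_const _)
  have hge : DifferentiableAt ℝ (fun y => fderiv ℝ g y (EuclideanSpace.single i 1)) x :=
    (hg2 x).clm_apply (differentiableAt_const _)
  rw [h1, fderiv_fun_sub hfe (hge.const_mul c), fderiv_const_mul hge]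
  simp

/-- One-dimensional second derivative test, necessary condition. -/
lemma deriv2_nonneg_of_isLocalMin {g : ℝ → ℝ} {x : ℝ} (hg : Continuous g) (h : IsLocalMin g x) :
    0 ≤ deriv (deriv g) x := by
  by_contra! hneg
  have hmax : IsLocalMax g x := isLocalMax_of_deriv_deriv_neg hneg h.deriv_eq_zero hg.continuousAt
  have heq : g =ᶠ[nhds x] fun _ => g x := by
    filter_upwards [h, hmax] with y h1 h2
    exact le_antisymm h2 h1
  have : deriv (deriv g) x = 0 := by
    rw [heq.deriv.deriv_eq]
    simp
  linarith

lemma lap_nonneg_of_isLocalMin {m : ℕ} {f : EuclideanSpace ℝ (Fin m) → ℝ} (hf : ContDiff ℝ 2 f)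
    {x : EuclideanSpace ℝ (Fin m)} (h : IsLocalMin f x) : 0 ≤ lap f x := by
  have hf1 : Differentiable ℝ f := hf.differentiable (by norm_num)
  have hf2 : Differentiable ℝ (fderiv ℝ f) :=
    (hf.fderiv_right (m := 1) (by norm_num)).differentiable (by norm_num)
  unfold lap
  refine Finset.sum_nonneg fun i _ => ?_
  set e : EuclideanSpace ℝ (Fin m) := EuclideanSpace.single i 1
  have hl : ∀ t : ℝ, HasDerivAt (fun t : ℝ => x + t • e) e t := fun t => by
    simpa using ((hasDerivAt_id t).smul_const e).const_add x
  have h1 : deriv (fun t : ℝ => f (x + t • e)) = fun t => fderiv ℝ f (x + t • e) e := by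
    funext t
    exact ((hf1 _).hasFDerivAt.comp_hasDerivAt t (hl t)).deriv
  have hfe : Differentiable ℝ (fun y => fderiv ℝ f y e) := fun y =>
    (hf2 y).clm_apply (differentiableAt_const _)
  have h2 : deriv (deriv (fun t : ℝ => f (x + t • e))) 0
      = fderiv ℝ (fun y => fderiv ℝ f y e) x e := by
    rw [h1]
    have := ((hfe (x + (0:ℝ) • e)).hasFDerivAt.comp_hasDerivAt 0 (hl 0)).deriv
    simpa [Function.comp_def] using this
  rw [← h2]
  have hc : Continuous (fun t : ℝ => x + t • e) := by fun_prop
  refine deriv2_nonneg_of_isLocalMin (hf.continuous.comp hc) ?_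
  have : Tendsto (fun t : ℝ => x + t • e) (nhds 0) (nhds x) := by
    simpa using hc.tendsto 0
  have h3 := this.eventually h
  unfold IsLocalMin IsMinFilter
  simpa using h3

lemma lap_radial {m : ℕ} (F F1 F2 : ℝ → ℝ) (hF : ∀ s, 0 ≤ s → HasDerivAt F (F1 s) s)
    (hF1 : ∀ s, 0 ≤ s → HasDerivAt F1 (F2 s) s) (y x : EuclideanSpace ℝ (Fin m)) :
    lap (fun z => F (‖z - y‖ ^ 2)) x
      = 4 * ‖x - y‖ ^ 2 * F2 (‖x - y‖ ^ 2) + 2 * m * F1 (‖x - y‖ ^ 2) := by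
  have hn : ∀ z : EuclideanSpace ℝ (Fin m), HasFDerivAt (fun z => ‖z - y‖ ^ 2)
      (2 • (innerSL ℝ (z - y))) z := fun z => by
    simpa using ((hasFDerivAt_id z).sub_const y).norm_sq
  have h1 : ∀ i : Fin m, (fun z => fderiv ℝ (fun z => F (‖z - y‖ ^ 2)) z
      (EuclideanSpace.single i 1)) = fun z => F1 (‖z - y‖ ^ 2) * (2 * (z i - y i)) := by
    intro i
    funext z
    have := ((hF (‖z - y‖ ^ 2) (by positivity)).comp_hasFDerivAt z (hn z)).fderiv
    simp only [Function.comp_def] at this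
    rw [this]
    simp [EuclideanSpace.inner_single_right]
  unfold lap
  have h2 : ∀ i : Fin m, fderiv ℝ (fun z => F1 (‖z - y‖ ^ 2) * (2 * (z i - y i))) x
      (EuclideanSpace.single i 1) = 4 * F2 (‖x - y‖ ^ 2) * ‖(x - y) i‖ ^ 2
        + 2 * F1 (‖x - y‖ ^ 2) := by
    intro i
    have hA := ((hF1 (‖x - y‖ ^ 2) (by positivity)).comp_hasFDerivAt x (hn x))
    have hp : HasFDerivAt (fun z : EuclideanSpace ℝ (Fin m) => z i)
        (EuclideanSpace.proj i : EuclideanSpace ℝ (Fin m) →L[ℝ] ℝ) x :=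
      (EuclideanSpace.proj i : EuclideanSpace ℝ (Fin m) →L[ℝ] ℝ).hasFDerivAt
    have hB := ((hp.sub_const (y i)).const_mul 2)
    have := (hA.mul hB).fderiv
    simp only [Function.comp_def] at this
    erw [this]
    simp [EuclideanSpace.inner_single_right]
    ring
  simp_rw [h1, h2]
  rw [Finset.sum_add_distrib, ← Finset.mul_sum, ← EuclideanSpace.norm_sq_eq]
  simp
  ring

/-- Strong maximum principle (Hopf barrier argument). -/
lemma pos_of_supersol {m : ℕ} {v k : EuclideanSpace ℝ (Fin m) → ℝ} (hv : ContDiff ℝ 2 v)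
    (hk : Continuous k) (hnn : ∀ x, 0 ≤ v x) (hle : ∀ x, lap v x ≤ k x * v x)
    (y₀ : EuclideanSpace ℝ (Fin m)) (hy₀ : 0 < v y₀) (x : EuclideanSpace ℝ (Fin m)) : 0 < v x := by
  by_contra! hx
  have hvc := hv.continuous
  set Z : Set (EuclideanSpace ℝ (Fin m)) := {x | v x ≤ 0} with hZ
  have hZc : IsClosed Z := isClosed_le hvc continuous_const
  obtain ⟨z, hzZ, hz⟩ := hZc.exists_infDist_eq_dist ⟨x, hx⟩ y₀
  have hz0 : v z = 0 := le_antisymm hzZ (hnn z)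
  have hzy : z ≠ y₀ := by rintro rfl; linarith
  -- centre of the touching ball
  set y : EuclideanSpace ℝ (Fin m) := midpoint ℝ y₀ z with hy
  set R : ℝ := ‖z - y‖ with hR
  have hRd : 2 * R = dist y₀ z := by
    have : dist z (midpoint ℝ y₀ z) = 2⁻¹ * dist y₀ z := by
      simp
    rw [hR, ← dist_eq_norm, hy, this]; ring
  have hRpos : 0 < R := by
    have := dist_pos.2 hzy.symm
    linarith
  have hRy : ‖y - y₀‖ = R := by
    have : dist (midpoint ℝ y₀ z) y₀ = 2⁻¹ * dist y₀ z := by simp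
    rw [← dist_eq_norm, hy, this, ← hRd]; ring
  -- the only zero in the closed ball around y is z
  have hpos : ∀ p, ‖p - y‖ ≤ R → p ≠ z → 0 < v p := by
    intro p hp hpz
    by_contra! hpv
    have h1 : dist y₀ z ≤ dist y₀ p := hz ▸ Metric.infDist_le_dist_of_mem (s := Z) hpv
    have e1 : ‖(p - y) + (y - y₀)‖ = ‖p - y‖ + ‖y - y₀‖ := by
      apply le_antisymm (norm_add_le _ _)
      have : (p - y) + (y - y₀) = p - y₀ := by abel
      rw [this, hRy, ← dist_eq_norm p y₀, dist_comm p y₀]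
      linarith
    have hpR : ‖p - y‖ = R := by
      apply le_antisymm hp
      have : (p - y) + (y - y₀) = p - y₀ := by abel
      rw [this, hRy, ← dist_eq_norm p y₀, dist_comm p y₀] at e1
      linarith
    have e2 : p - y = y - y₀ := by
      have hs := (sameRay_iff_norm_add.2 e1)
      exact hs.eq_of_norm_eq (hpR.trans hRy.symm)
    apply hpz
    have e3 : z - y = y - y₀ := by
      rw [hy]
      simp [midpoint_eq_smul_add]
      module
    have := e2.trans e3.symm
    simpa using this
  set ρ : ℝ := R / 2 with hρ
  have hρpos : 0 < ρ := by positivity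
  have hcomp : IsCompact (closedBall z ρ) := isCompact_closedBall z ρ
  obtain ⟨M₀, hM₀⟩ := hcomp.exists_bound_of_continuousOn hk.continuousOn
  set M : ℝ := max M₀ 0 with hM
  have hkM : ∀ p ∈ closedBall z ρ, k p ≤ M := fun p hp =>
    (le_abs_self _).trans ((hM₀ p hp).trans (le_max_left _ _))
  have hM0 : 0 ≤ M := le_max_right _ _
  -- exponent
  obtain ⟨α, hα1, hα⟩ : ∃ α : ℝ, 0 < α ∧ M < 4 * α ^ 2 * ρ ^ 2 - 2 * m * α := by
    have hρ2 : 0 < ρ ^ 2 := by positivity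
    refine ⟨(2 * m + M + 1) / (4 * ρ ^ 2) + 1, by positivity, ?_⟩
    set α := (2 * m + M + 1) / (4 * ρ ^ 2) + 1 with hα
    have h1 : 1 ≤ α := by
      have : 0 ≤ (2 * m + M + 1) / (4 * ρ ^ 2) := by positivity
      linarith
    have h2 : 2 * m + M + 1 ≤ 4 * ρ ^ 2 * α := by
      have : 4 * ρ ^ 2 * α = 2 * m + M + 1 + 4 * ρ ^ 2 := by
        rw [hα]; field_simp
      linarith
    have h3 : M + 1 ≤ 4 * ρ ^ 2 * α - 2 * m := by linarith
    have h4 : (M + 1) * 1 ≤ (4 * ρ ^ 2 * α - 2 * m) * α :=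
      mul_le_mul h3 h1 (by norm_num) (by linarith)
    nlinarith
  set E : ℝ := Real.exp (-α * R ^ 2) with hE
  set h : EuclideanSpace ℝ (Fin m) → ℝ := fun p => Real.exp (-α * ‖p - y‖ ^ 2) - E with hh
  have hhC : ContDiff ℝ 2 h := by
    have : ContDiff ℝ 2 (fun p : EuclideanSpace ℝ (Fin m) => ‖p - y‖ ^ 2) :=
      (contDiff_id.sub contDiff_const).norm_sq ℝ
    exact (Real.contDiff_exp.comp (contDiff_const.mul this)).sub contDiff_const
  have hlap : ∀ p, lap h p = (4 * α ^ 2 * ‖p - y‖ ^ 2 - 2 * m * α)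
      * Real.exp (-α * ‖p - y‖ ^ 2) := by
    intro p
    have hlin : ∀ s : ℝ, HasDerivAt (fun s : ℝ => -α * s) (-α) s := fun s => by
      simpa using (hasDerivAt_id s).const_mul (-α)
    have := lap_radial (m := m) (fun s => Real.exp (-α * s) - E)
      (fun s => -α * Real.exp (-α * s)) (fun s => α ^ 2 * Real.exp (-α * s))
      (fun s _ => by
        exact (((hlin s).exp).sub_const E).congr_deriv (by ring))
      (fun s _ => by
        exact (((hlin s).exp).const_mul (-α)).congr_deriv (by ring)) y p
    rw [hh, this]; ring
  have hsub : ∀ p ∈ closedBall z ρ, M * h p < lap h p := by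
    intro p hp
    rw [hlap]
    have hr : ρ ≤ ‖p - y‖ := by
      have h1 : ‖p - z‖ ≤ ρ := by simpa [dist_eq_norm] using hp
      have h2 : ‖z - y‖ ≤ ‖p - z‖ + ‖p - y‖ := by
        have : z - y = -(p - z) + (p - y) := by abel
        rw [this]
        exact (norm_add_le _ _).trans (by rw [norm_neg])
      linarith
    have hr2 : ρ ^ 2 ≤ ‖p - y‖ ^ 2 := by gcongr
    have hE0 : 0 < E := Real.exp_pos _
    have h3 : M * h p ≤ M * Real.exp (-α * ‖p - y‖ ^ 2) := by
      apply mul_le_mul_of_nonneg_left _ hM0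
      simp only [hh]; linarith
    refine h3.trans_lt (mul_lt_mul_of_pos_right ?_ (Real.exp_pos _))
    have : 4 * α ^ 2 * ρ ^ 2 ≤ 4 * α ^ 2 * ‖p - y‖ ^ 2 := by gcongr
    linarith
  -- lower bound on the part of the sphere inside the touching ball
  obtain ⟨c, hc, hcv⟩ : ∃ c : ℝ, 0 < c ∧ ∀ p ∈ sphere z ρ ∩ closedBall y R, c ≤ v p := by
    have hK : IsCompact (sphere z ρ ∩ closedBall y R) :=
      (isCompact_sphere z ρ).inter_right isClosed_closedBall
    rcases (sphere z ρ ∩ closedBall y R).eq_empty_or_nonempty with he | hne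
    · exact ⟨1, one_pos, by simp [he]⟩
    · obtain ⟨q, hq, hqm⟩ := hK.exists_isMinOn hne hvc.continuousOn
      refine ⟨v q, hpos q (by simpa [dist_eq_norm] using hq.2) ?_, fun p hp => hqm hp⟩
      rintro rfl
      have := hq.1
      simp at this
      linarith
  have hφC : ContDiff ℝ 2 (fun p => v p - c * h p) := hv.sub (contDiff_const.mul hhC)
  have hhz : h z = 0 := by simp [hh, hE, hR]
  have hbd : ∀ p ∈ sphere z ρ, 0 ≤ v p - c * h p := by
    intro p hp
    by_cases hpy : ‖p - y‖ ≤ R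
    · have h1 := hcv p ⟨hp, by simpa [dist_eq_norm] using hpy⟩
      have h2 : h p ≤ 1 := by
        have : Real.exp (-α * ‖p - y‖ ^ 2) ≤ 1 := by
          rw [Real.exp_le_one_iff]
          have : 0 ≤ α * ‖p - y‖ ^ 2 := by positivity
          linarith
        have hE0 : 0 < E := Real.exp_pos _
        simp only [hh]; linarith
      nlinarith
    · push Not at hpy
      have h2 : h p ≤ 0 := by
        simp only [hh, hE]
        rw [sub_nonpos, Real.exp_le_exp]
        have : R ^ 2 ≤ ‖p - y‖ ^ 2 := by gcongr
        nlinarith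
      have := hnn p
      nlinarith
  -- an interior minimum with nonpositive value
  obtain ⟨p, hpB, hpmin, hpv⟩ : ∃ p ∈ ball z ρ, IsLocalMin (fun p => v p - c * h p) p ∧
      v p - c * h p ≤ 0 := by
    obtain ⟨q, hq, hqm⟩ := hcomp.exists_isMinOn ⟨z, mem_closedBall_self hρpos.le⟩
      hφC.continuous.continuousOn
    have hqz : v q - c * h q ≤ v z - c * h z := hqm (mem_closedBall_self hρpos.le)
    rw [hz0, hhz] at hqz
    by_cases hqs : q ∈ sphere z ρ
    · have hq0 := hbd q hqs
      refine ⟨z, mem_ball_self hρpos, ?_, by simp [hz0, hhz]⟩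
      filter_upwards [closedBall_mem_nhds z hρpos] with p hp
      have : v q - c * h q ≤ v p - c * h p := hqm hp
      rw [hz0, hhz]; linarith
    · have hqb : q ∈ ball z ρ := by
        rw [mem_ball]; exact lt_of_le_of_ne hq hqs
      refine ⟨q, hqb, ?_, by linarith⟩
      exact hqm.isLocalMin (closedBall_mem_nhds_of_mem hqb)
  have hpC := ball_subset_closedBall hpB
  have h1 := lap_nonneg_of_isLocalMin hφC hpmin
  rw [lap_sub_mul hv hhC] at h1
  have h2 := hsub p hpC
  have h3 := hle p
  have h4 : k p * v p ≤ M * v p := mul_le_mul_of_nonneg_right (hkM p hpC) (hnn p)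
  have h5 : M * v p ≤ M * (c * h p) := mul_le_mul_of_nonneg_left (by linarith) hM0
  have h6 := mul_lt_mul_of_pos_left h2 hc
  nlinarith

/-- A weak maximum principle at infinity. -/
lemma weak_max {m : ℕ} {w : EuclideanSpace ℝ (Fin m) → ℝ} (hw : ContDiff ℝ 2 w) (c δ : ℝ)
    (hc : 0 < c) (hδ : 0 < δ) (hw0 : ∀ x, w x ≤ 0) (hsup : ∃ x, -δ < w x)
    (hlap : ∀ x, -δ < w x → c / (1 + ‖x‖ ^ 2) ≤ lap w x) : False := by
  obtain ⟨x₀, hx₀⟩ := hsup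
  set ψ : EuclideanSpace ℝ (Fin m) → ℝ := fun x => Real.log (1 + ‖x - 0‖ ^ 2) with hψ
  have hψC : ContDiff ℝ 2 ψ := by
    have : ContDiff ℝ 2 (fun p : EuclideanSpace ℝ (Fin m) => 1 + ‖p - 0‖ ^ 2) :=
      contDiff_const.add ((contDiff_id.sub contDiff_const).norm_sq ℝ)
    exact this.log fun x => by positivity
  have hψlap : ∀ x, lap ψ x ≤ 2 * m / (1 + ‖x‖ ^ 2) := by
    intro x
    have hlin : ∀ s : ℝ, HasDerivAt (fun s : ℝ => 1 + s) 1 s := fun s => by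
      simpa using (hasDerivAt_id s).const_add 1
    have := lap_radial (m := m) (fun s => Real.log (1 + s))
      (fun s => 1 / (1 + s)) (fun s => -1 / (1 + s) ^ 2)
      (fun s hs => (hlin s).log (by positivity))
      (fun s hs => by
        have := (hlin s).inv (by positivity)
        simpa [Pi.inv_def] using this) 0 x
    rw [hψ, this, sub_zero]
    have h1 : 0 ≤ 4 * ‖x‖ ^ 2 * (1 / (1 + ‖x‖ ^ 2) ^ 2) := by positivity
    have h2 : 4 * ‖x‖ ^ 2 * (-1 / (1 + ‖x‖ ^ 2) ^ 2)
      = - (4 * ‖x‖ ^ 2 * (1 / (1 + ‖x‖ ^ 2) ^ 2)) := by ring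
    have h3 : 2 * m * (1 / (1 + ‖x‖ ^ 2)) = 2 * m / (1 + ‖x‖ ^ 2) := by ring
    linarith
  have hψ0 : ∀ x, 0 ≤ ψ x := fun x => Real.log_nonneg (by
    have : 0 ≤ ‖x - 0‖ ^ 2 := by positivity
    linarith)
  have hψt : Tendsto ψ (cocompact _) atTop := by
    refine Real.tendsto_log_atTop.comp (tendsto_atTop_add_const_left _ _ ?_)
    simp only [sub_zero]
    exact (tendsto_pow_atTop two_ne_zero).comp (tendsto_norm_cocompact_atTop)
  -- choice of the perturbation parameter
  obtain ⟨ε, hε, hε1, hε2⟩ : ∃ ε : ℝ, 0 < ε ∧ ε * ψ x₀ < w x₀ + δ ∧ ε * (2 * m) < c := by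
    have hd : 0 < w x₀ + δ := by linarith
    refine ⟨min ((w x₀ + δ) / (ψ x₀ + 1)) (c / (2 * m + 1)), ?_, ?_, ?_⟩
    · have := hψ0 x₀
      positivity
    · have h0 := hψ0 x₀
      calc _ ≤ (w x₀ + δ) / (ψ x₀ + 1) * ψ x₀ :=
            mul_le_mul_of_nonneg_right (min_le_left _ _) h0
        _ < w x₀ + δ := by
            rw [div_mul_eq_mul_div, div_lt_iff₀ (by linarith)]
            nlinarith
    · calc _ ≤ c / (2 * m + 1) * (2 * m) :=
            mul_le_mul_of_nonneg_right (min_le_right _ _) (by positivity)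
        _ < c := by
            rw [div_mul_eq_mul_div, div_lt_iff₀ (by positivity)]
            nlinarith
  have hφC : ContDiff ℝ 2 (fun x => ε * ψ x - 1 * w x) :=
    (contDiff_const.mul hψC).sub (contDiff_const.mul hw)
  have hφt : Tendsto (fun x => ε * ψ x - 1 * w x) (cocompact _) atTop := by
    refine tendsto_atTop_mono (fun x => ?_) (hψt.const_mul_atTop hε)
    have := hw0 x
    linarith
  obtain ⟨p, hp⟩ := hφC.continuous.exists_forall_le hφt
  have hloc : IsLocalMin (fun x => ε * ψ x - 1 * w x) p := Eventually.of_forall hp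
  have h1 := lap_nonneg_of_isLocalMin hφC hloc
  rw [lap_sub_mul (contDiff_const.mul hψC) hw] at h1
  have h2 : lap (fun x => ε * ψ x) p = ε * lap ψ p := by
    have h0 := lap_sub_mul (contDiff_const (c := (0:ℝ))) hψC (-ε) p
    have hz : lap (fun _ : EuclideanSpace ℝ (Fin m) => (0:ℝ)) p = 0 := by simp [lap]
    rw [hz] at h0
    simpa using h0
  have hpp := hp x₀
  have hp0 := mul_nonneg hε.le (hψ0 p)
  have hwp : -δ < w p := by linarith
  have h3 := hlap p hwp
  have h4 := mul_le_mul_of_nonneg_left (hψlap p) hε.le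
  have h5 : ε * (2 * m / (1 + ‖p‖ ^ 2)) < c / (1 + ‖p‖ ^ 2) := by
    rw [← mul_div_assoc]
    exact div_lt_div_of_pos_right hε2 (by positivity)
  linarith

/-- Global two-sided positive bounds for a solution. -/
lemma sol_bounds {m : ℕ} (hm : 2 ≤ m) {a b v : EuclideanSpace ℝ (Fin m) → ℝ}
    (ha : Continuous a) (hb : Continuous b) {σ : ℝ} (hσ : 1 < σ)
    (hvC2 : ContDiff ℝ 2 v) (hvnn : ∀ x, 0 ≤ v x)
    (hveq : ∀ x, lap v x + a x * v x - b x * v x ^ σ = 0)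
    (hvlb : ∃ ε > (0:ℝ), ∀ᶠ x in Filter.cocompact (EuclideanSpace ℝ (Fin m)), ε ≤ v x)
    (hvub : ∃ M : ℝ, ∀ᶠ x in Filter.cocompact (EuclideanSpace ℝ (Fin m)), v x ≤ M) :
    ∃ ε M : ℝ, 0 < ε ∧ ∀ x, ε ≤ v x ∧ v x ≤ M := by
  have hvc := hvC2.continuous
  have : Nonempty (Fin m) := ⟨⟨0, by omega⟩⟩
  have : NoncompactSpace (EuclideanSpace ℝ (Fin m)) := NormedSpace.noncompactSpace ℝ _
  obtain ⟨ε, hε, hev⟩ := hvlb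
  obtain ⟨M, hMv⟩ := hvub
  obtain ⟨y₀, hy₀⟩ := hev.exists
  have hpos : ∀ x, 0 < v x := by
    refine pos_of_supersol (k := fun x => b x * v x ^ (σ - 1) - a x) hvC2 ?_ hvnn ?_ y₀ (by linarith)
    · exact (hb.mul (hvc.rpow_const fun x => Or.inr (by linarith))).sub ha
    · intro x
      have h1 : v x ^ σ = v x ^ (σ - 1) * v x := by
        rcases (hvnn x).eq_or_lt with h | h
        · rw [← h, Real.zero_rpow (by linarith)]; simp
        · rw [Real.rpow_sub_one h.ne']; field_simp
      have := hveq x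
      rw [h1] at this
      apply le_of_eq
      linear_combination this
  obtain ⟨K, hK, hKs⟩ := mem_cocompact.1 (hev.and hMv)
  rcases K.eq_empty_or_nonempty with he | hne
  · refine ⟨ε, M, hε, fun x => hKs (by simp [he])⟩
  · obtain ⟨p, hp, hpm⟩ := hK.exists_isMinOn hne hvc.continuousOn
    obtain ⟨q, hq, hqm⟩ := hK.exists_isMaxOn hne hvc.continuousOn
    refine ⟨min ε (v p), max M (v q), lt_min hε (hpos p), fun x => ?_⟩
    by_cases hx : x ∈ K
    · exact ⟨(min_le_right _ _).trans (hpm hx), le_trans (hqm hx) (le_max_right _ _)⟩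
    · have := hKs hx
      exact ⟨(min_le_left _ _).trans this.1, this.2.trans (le_max_left _ _)⟩

lemma sol_le {m : ℕ} {a b : EuclideanSpace ℝ (Fin m) → ℝ}
    {C : ℝ} (hC : 0 < C) (hblow : ∀ x, C / (1 + ‖x‖ ^ 2) ≤ b x)
    {S : ℝ} (hS : 0 ≤ S) (hab : ∀ x, - a x ≤ S * b x)
    {σ : ℝ} (hσ : 1 < σ) {u v : EuclideanSpace ℝ (Fin m) → ℝ}
    (huC2 : ContDiff ℝ 2 u) (hvC2 : ContDiff ℝ 2 v)
    (hueq : ∀ x, lap u x + a x * u x - b x * u x ^ σ = 0)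
    (hveq : ∀ x, lap v x + a x * v x - b x * v x ^ σ = 0)
    {Mu ε Mv : ℝ} (hε : 0 < ε) (hu0 : ∀ x, 0 ≤ u x) (hu : ∀ x, u x ≤ Mu) (hv : ∀ x, ε ≤ v x)
    (hv' : ∀ x, v x ≤ Mv) (x : EuclideanSpace ℝ (Fin m)) : u x ≤ v x := by
  by_contra! hx
  have hvp : ∀ x, 0 < v x := fun x => hε.trans_le (hv x)
  have hbp : ∀ x, 0 < b x := fun x => lt_of_lt_of_le (by positivity) (hblow x)
  have hMv : 0 < Mv := (hvp x).trans_le (hv' x)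
  have hMu : 0 ≤ Mu := (hu0 x).trans (hu x)
  have hbdd : BddAbove (range fun x => u x / v x) := by
    refine ⟨Mu / ε, ?_⟩
    rintro _ ⟨y, rfl⟩
    exact div_le_div₀ hMu (hu y) hε (hv y)
  set T : ℝ := ⨆ x, u x / v x with hT
  have hT1 : 1 < T := ((one_lt_div (hvp x)).2 hx).trans_le (le_ciSup hbdd x)
  have huT : ∀ y, u y ≤ T * v y := fun y => (div_le_iff₀ (hvp y)).1 (le_ciSup hbdd y)
  have hT0 : 0 < T := by linarith
  -- intermediate ratio
  obtain ⟨T₁, hT₁0, hT₁T, hT₁σ⟩ : ∃ T₁ : ℝ, 0 < T₁ ∧ T₁ < T ∧ T < T₁ ^ σ := by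
    obtain ⟨s, hs1, hs2⟩ := exists_between (show 1 / σ < 1 by rw [div_lt_one (by linarith)]; exact hσ)
    refine ⟨T ^ s, by positivity, ?_, ?_⟩
    · simpa using Real.rpow_lt_rpow_of_exponent_lt hT1 hs2
    · rw [← Real.rpow_mul hT0.le]
      have : 1 < s * σ := (div_lt_iff₀ (by linarith)).1 hs1
      simpa using Real.rpow_lt_rpow_of_exponent_lt hT1 this
  set c : ℝ := (T₁ ^ σ - T) * ε ^ σ with hc
  have hcp : 0 < c := mul_pos (by linarith) (by positivity)
  set δ : ℝ := min ((T - T₁) * ε) (c / (2 * (S + 1))) with hδ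
  have hδp : 0 < δ := lt_min (mul_pos (by linarith) hε) (by positivity)
  have hSδ : S * δ ≤ c / 2 := by
    calc S * δ ≤ (S + 1) * (c / (2 * (S + 1))) := by
          apply mul_le_mul (by linarith) (min_le_right _ _) hδp.le (by linarith)
      _ = c / 2 := by field_simp
  refine weak_max (w := fun x => u x - T * v x) (huC2.sub (contDiff_const.mul hvC2))
    (C * (c / 2)) δ (by positivity) hδp (fun y => by linarith [huT y]) ?_ ?_
  · obtain ⟨y, hy⟩ := exists_lt_of_lt_ciSup (show T - δ / Mv < ⨆ x, u x / v x by
      have : 0 < δ / Mv := by positivity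
      linarith)
    refine ⟨y, ?_⟩
    rw [lt_div_iff₀ (hvp y)] at hy
    have : δ / Mv * v y ≤ δ := by
      rw [div_mul_eq_mul_div, div_le_iff₀ hMv]
      exact mul_le_mul_of_nonneg_left (hv' y) hδp.le
    linarith
  · intro y hy
    rw [lap_sub_mul huC2 hvC2]
    have hT₁v : T₁ * v y ≤ u y := by
      have h1 : δ ≤ (T - T₁) * ε := min_le_left _ _
      have h2 : (T - T₁) * ε ≤ (T - T₁) * v y :=
        mul_le_mul_of_nonneg_left (hv y) (by linarith)
      linarith
    have h1 : T₁ ^ σ * v y ^ σ ≤ u y ^ σ := by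
      rw [← Real.mul_rpow hT₁0.le (hvp y).le]
      exact Real.rpow_le_rpow (mul_pos hT₁0 (hvp y)).le hT₁v (by linarith)
    have h2 : ε ^ σ ≤ v y ^ σ := Real.rpow_le_rpow hε.le (hv y) (by linarith)
    have h3 : c ≤ u y ^ σ - T * v y ^ σ := by
      have := mul_le_mul_of_nonneg_left h2 (show 0 ≤ T₁ ^ σ - T by linarith)
      linarith
    set d : ℝ := T * v y - u y with hd
    have hd0 : 0 ≤ d := by linarith [huT y]
    have hdδ : d ≤ δ := by linarith
    have h4 : -(S * b y) * d ≤ a y * d := mul_le_mul_of_nonneg_right (by linarith [hab y]) hd0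
    have h5 : S * d ≤ c / 2 := (mul_le_mul_of_nonneg_left hdδ hS).trans hSδ
    have h6 : b y * (c / 2) ≤ b y * (u y ^ σ - T * v y ^ σ - S * d) :=
      mul_le_mul_of_nonneg_left (by linarith) (hbp y).le
    have h7 : C / (1 + ‖y‖ ^ 2) * (c / 2) ≤ b y * (c / 2) :=
      mul_le_mul_of_nonneg_right (hblow y) (by positivity)
    have h8 : lap u y - T * lap v y = a y * d + b y * (u y ^ σ - T * v y ^ σ) := by
      rw [hd]
      linear_combination hueq y - T * hveq y
    have h9 : C * (c / 2) / (1 + ‖y‖ ^ 2) = C / (1 + ‖y‖ ^ 2) * (c / 2) := by ring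
    rw [h8, h9]
    linarith

/-- uniqueness of bounded solutions bounded away from zero.
The condition `0 < liminf u ≤ limsup u < ∞` at infinity is expressed by eventual
bounds along the cocompact filter. -/
theorem stmt_4 {m : ℕ} (hm : 2 ≤ m) (a b : EuclideanSpace ℝ (Fin m) → ℝ)
    (ha : Continuous a) (hb : Continuous b)
    (C μ : ℝ) (hC : 0 < C) (hμ0 : 0 ≤ μ) (hμ2 : μ < 2)
    (hblow : ∀ x, C * (1 + ‖x‖) ^ (-μ) ≤ b x)
    (hab : ∃ S : ℝ, ∀ x, max (-a x) 0 / b x ≤ S)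
    (σ : ℝ) (hσ : 1 < σ)
    (u v : EuclideanSpace ℝ (Fin m) → ℝ)
    (huC2 : ContDiff ℝ 2 u) (hvC2 : ContDiff ℝ 2 v)
    (hunn : ∀ x, 0 ≤ u x) (hvnn : ∀ x, 0 ≤ v x)
    (hueq : ∀ x, lap u x + a x * u x - b x * u x ^ σ = 0)
    (hveq : ∀ x, lap v x + a x * v x - b x * v x ^ σ = 0)
    (hulb : ∃ ε > (0:ℝ), ∀ᶠ x in Filter.cocompact (EuclideanSpace ℝ (Fin m)), ε ≤ u x)
    (huub : ∃ M : ℝ, ∀ᶠ x in Filter.cocompact (EuclideanSpace ℝ (Fin m)), u x ≤ M)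
    (hvlb : ∃ ε > (0:ℝ), ∀ᶠ x in Filter.cocompact (EuclideanSpace ℝ (Fin m)), ε ≤ v x)
    (hvub : ∃ M : ℝ, ∀ᶠ x in Filter.cocompact (EuclideanSpace ℝ (Fin m)), v x ≤ M) :
    u = v := by
  obtain ⟨S, hS⟩ := hab
  have hbl : ∀ x, C / 2 / (1 + ‖x‖ ^ 2) ≤ b x := by
    intro x
    refine le_trans ?_ (hblow x)
    have hn := norm_nonneg x
    have h1 : (1 + ‖x‖) ^ (-2 : ℝ) ≤ (1 + ‖x‖) ^ (-μ) :=
      Real.rpow_le_rpow_of_exponent_le (by linarith) (by linarith)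
    have h2 : (1 + ‖x‖) ^ (-2 : ℝ) = 1 / (1 + ‖x‖) ^ 2 := by
      rw [Real.rpow_neg (by positivity)]
      norm_cast
      simp
    have h3 : 1 / (2 * (1 + ‖x‖ ^ 2)) ≤ 1 / (1 + ‖x‖) ^ 2 := by
      apply one_div_le_one_div_of_le (by positivity)
      nlinarith [sq_nonneg (1 - ‖x‖)]
    have h4 : C / 2 / (1 + ‖x‖ ^ 2) = C * (1 / (2 * (1 + ‖x‖ ^ 2))) := by
      field_simp
    rw [h4]
    exact mul_le_mul_of_nonneg_left (by linarith) hC.le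
  have hbp : ∀ x, 0 < b x := fun x => lt_of_lt_of_le (by positivity) (hbl x)
  have hS' : ∀ x, - a x ≤ max S 0 * b x := by
    intro x
    have h1 := (div_le_iff₀ (hbp x)).1 (hS x)
    have h2 := mul_le_mul_of_nonneg_right (le_max_left S 0) (hbp x).le
    have h3 := le_max_left (- a x) 0
    linarith
  obtain ⟨εu, Mu, hεu, hub⟩ := sol_bounds hm ha hb hσ huC2 hunn hueq hulb huub
  obtain ⟨εv, Mv, hεv, hvb⟩ := sol_bounds hm ha hb hσ hvC2 hvnn hveq hvlb hvub
  funext x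
  exact le_antisymm
    (sol_le (by positivity) hbl (le_max_right S 0) hS' hσ huC2 hvC2 hueq hveq hεv hunn
      (fun x => (hub x).2) (fun x => (hvb x).1) (fun x => (hvb x).2) x)
    (sol_le (by positivity) hbl (le_max_right S 0) hS' hσ hvC2 huC2 hveq hueq hεu hvnn
      (fun x => (hvb x).2) (fun x => (hub x).1) (fun x => (hub x).2) x)
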